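/- Fix probability vectors p = (p_w, p_d, p_ℓ) and q = (q_w, q_d, q_ℓ). If Off is strictly losing and the defensive style is fair but non-safe, i.e. p_w < p_ℓ and q_w = q_ℓ > 0, then the optimal gain satisfies g*_N ≥ 0 for every N ≥ 1 and g*_N → 0 as N → ∞. -/

import Mathlib

noncomputable section

open Filter Topology Finset

/-- The sign of an integer score, as a real number (`sgn 0 = 0`). -/
def sgn (x : ℤ) : ℝ := if 0 < x then 1 else if x < 0 then -1 else 0

/-- Expected sign of the score after one more game played with win/draw/loss
probabilities `w, d, l`, starting from score `x`. -/
def stepVal (w d l : ℝ) (x : ℤ) : ℝ := w * sgn (x + 1) + d * sgn x + l * sgn (x - 1)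

/-- Bellman value function with `k` games remaining: `bellman p q k x = V_{N-k}^N(x)`.
With no game remaining the value is the sign of the score; otherwise Player 1 picks the
better of the offensive style `(pw, pd, pl)` and the defensive style `(qw, qd, ql)`. -/
def bellman (pw pd pl qw qd ql : ℝ) : ℕ → ℤ → ℝ
  | 0, x => sgn x
  | k + 1, x =>
      max
        (pw * bellman pw pd pl qw qd ql k (x + 1) + pd * bellman pw pd pl qw qd ql k x +
          pl * bellman pw pd pl qw qd ql k (x - 1))
        (qw * bellman pw pd pl qw qd ql k (x + 1) + qd * bellman pw pd pl qw qd ql k x +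
          ql * bellman pw pd pl qw qd ql k (x - 1))

/-- Optimal gain over `N` games: `g*_N = V_0^N(0)`. -/
def gOpt (pw pd pl qw qd ql : ℝ) (N : ℕ) : ℝ := bellman pw pd pl qw qd ql N 0

/-- The two playing styles of Player 1. -/
inductive Style
  | offense
  | defense
deriving DecidableEq

/-- Selects the probability attached to a style: `a` for offense, `b` for defense. -/
def styleP (a b : ℝ) : Style → ℝ
  | .offense => a
  | .defense => b

/-- Probability mass function of the score process `X_n` under the policy `π`
(playing `π n x` at round `n+1` when the current score is `x`), started at `X_0 = 0`. -/
def polDist (pw pd pl qw qd ql : ℝ) (π : ℕ → ℤ → Style) : ℕ → ℤ → ℝ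
  | 0, x => if x = 0 then 1 else 0
  | n + 1, x =>
      polDist pw pd pl qw qd ql π n (x - 1) * styleP pw qw (π n (x - 1)) +
      polDist pw pd pl qw qd ql π n x * styleP pd qd (π n x) +
      polDist pw pd pl qw qd ql π n (x + 1) * styleP pl ql (π n (x + 1))

/-- Gain of policy `π` over `n` games: `g_n^π = E[sign (X_n)]`. -/
def gPol (pw pd pl qw qd ql : ℝ) (π : ℕ → ℤ → Style) (n : ℕ) : ℝ :=
  ∑' x : ℤ, polDist pw pd pl qw qd ql π n x * sgn x

/-- Probability mass function of the pair (score, switched-to-defense flag) under the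
catenaccio policy: play offense until the score first reaches `+1`, then defense forever. -/
def catDist (pw pd pl qw qd ql : ℝ) : ℕ → ℤ → Bool → ℝ
  | 0, x, b => if x = 0 ∧ b = false then 1 else 0
  | n + 1, x, true =>
      catDist pw pd pl qw qd ql n (x - 1) true * qw +
      catDist pw pd pl qw qd ql n x true * qd +
      catDist pw pd pl qw qd ql n (x + 1) true * ql +
      (if x = 1 then
        catDist pw pd pl qw qd ql n 0 false * pw +
        catDist pw pd pl qw qd ql n 1 false * pd +
        catDist pw pd pl qw qd ql n 2 false * pl
       else 0)
  | n + 1, x, false =>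
      if x = 1 then 0
      else
        catDist pw pd pl qw qd ql n (x - 1) false * pw +
        catDist pw pd pl qw qd ql n x false * pd +
        catDist pw pd pl qw qd ql n (x + 1) false * pl

/-- Gain of the catenaccio policy over `N` games: `g_N^(cat) = E[sign (X_N)]`. -/
def gCat (pw pd pl qw qd ql : ℝ) (N : ℕ) : ℝ :=
  ∑' x : ℤ,
    (catDist pw pd pl qw qd ql N x false + catDist pw pd pl qw qd ql N x true) * sgn x

/-- Gain of the catenaccio+ policy over `N` games: play catenaccio, except that if the
score after `N - 1` games is `0`, the last game is played with the better of the two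
styles (offense if `pw - pl > qw - ql`, defense otherwise). -/
def gCatPlus (pw pd pl qw qd ql : ℝ) : ℕ → ℝ
  | 0 => 0
  | N + 1 =>
      ∑' x : ℤ,
        (catDist pw pd pl qw qd ql N x false *
            (if x = 0 then (if pw - pl > qw - ql then pw - pl else qw - ql)
             else stepVal pw pd pl x) +
          catDist pw pd pl qw qd ql N x true *
            (if x = 0 then (if pw - pl > qw - ql then pw - pl else qw - ql)
             else stepVal qw qd ql x))

/-- Probability mass function of the lazy random walk with i.i.d. increments (+1 with
probability `qw`, 0 with probability `qd`, −1 with probability `ql`), started at `0`. -/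
def walkDist (qw qd ql : ℝ) : ℕ → ℤ → ℝ
  | 0, x => if x = 0 then 1 else 0
  | n + 1, x =>
      walkDist qw qd ql n (x - 1) * qw + walkDist qw qd ql n x * qd +
        walkDist qw qd ql n (x + 1) * ql

/-- Fixed-style gain over `N` games for the walk with step law `(qw, qd, ql)`. -/
def gFixed (qw qd ql : ℝ) (N : ℕ) : ℝ := ∑' x : ℤ, walkDist qw qd ql N x * sgn x

/-- Probability mass function of the lazy random walk with step law `(pw, pd, pl)`,
started at `0` and absorbed (stopped) at the level `+1`.  In particular
`stoppedDist pw pd pl n 1` is the probability that the walk reaches `+1` by time `n`. -/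
def stoppedDist (pw pd pl : ℝ) : ℕ → ℤ → ℝ
  | 0, x => if x = 0 then 1 else 0
  | n + 1, x =>
      if x = 1 then
        stoppedDist pw pd pl n 1 + stoppedDist pw pd pl n 0 * pw +
          stoppedDist pw pd pl n 2 * pl
      else
        (if x - 1 = 1 then 0 else stoppedDist pw pd pl n (x - 1) * pw) +
          stoppedDist pw pd pl n x * pd +
          (if x + 1 = 1 then 0 else stoppedDist pw pd pl n (x + 1) * pl)

/-- One step of the symmetric lazy random walk with jump probability `q` in each direction,
acting on functions of the score. -/
def heatStep (q : ℝ) (f : ℤ → ℝ) (x : ℤ) : ℝ := q * f (x + 1) + (1 - 2 * q) * f x + q * f (x - 1)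

/-- Expectation of `f` after `k` steps of the symmetric lazy random walk started at `x`. -/
def heat (q : ℝ) (f : ℤ → ℝ) : ℕ → ℤ → ℝ
  | 0 => f
  | k + 1 => heatStep q (heat q f k)

/-- The unnormalised Fourier integral for the transition kernel of the lazy random walk. -/
def heatKernel (q : ℝ) (k : ℕ) (x : ℤ) : ℝ :=
  ∫ θ in (0 : ℝ)..Real.pi, Real.cos (x * θ) * (1 - 2 * q + 2 * q * Real.cos θ) ^ k

lemma heatStep_mono {q : ℝ} (h0 : 0 ≤ q) (h1 : 2 * q ≤ 1) {f g : ℤ → ℝ} (h : ∀ x, f x ≤ g x)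
    (x : ℤ) : heatStep q f x ≤ heatStep q g x := by
  unfold heatStep
  have := mul_le_mul_of_nonneg_left (h (x + 1)) h0
  have := mul_le_mul_of_nonneg_left (h (x - 1)) h0
  have := mul_le_mul_of_nonneg_left (h x) (sub_nonneg.2 h1)
  linarith

lemma heat_mono {q : ℝ} (h0 : 0 ≤ q) (h1 : 2 * q ≤ 1) {f g : ℤ → ℝ} (h : ∀ x, f x ≤ g x)
    (k : ℕ) (x : ℤ) : heat q f k x ≤ heat q g k x := by
  induction k generalizing x with
  | zero => exact h x
  | succ k ih => exact heatStep_mono h0 h1 ih x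

lemma heat_odd (q : ℝ) {f : ℤ → ℝ} (h : ∀ x, f (-x) = -f x) (k : ℕ) (x : ℤ) :
    heat q f k (-x) = -heat q f k x := by
  induction k generalizing x with
  | zero => exact h x
  | succ k ih =>
    simp only [heat, heatStep]
    rw [show -x + 1 = -(x - 1) by ring, show -x - 1 = -(x + 1) by ring, ih, ih, ih]
    ring

lemma sgn_neg (x : ℤ) : sgn (-x) = -sgn x := by
  unfold sgn
  split_ifs <;> first | omega | simp

lemma heat_sgn_zero (q : ℝ) (k : ℕ) : heat q sgn k 0 = 0 := by
  have := heat_odd q sgn_neg k 0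
  rw [neg_zero] at this
  linarith

/-- A bound on second differences relative to first differences is preserved by the walk. -/
lemma heat_second_difference {q c e : ℝ} (h0 : 0 ≤ q) (h1 : 2 * q ≤ 1) {f : ℤ → ℝ}
    (h : ∀ x, c * (f (x + 1) - 2 * f x + f (x - 1)) ≤ e * (f x - f (x - 1))) (k : ℕ) (x : ℤ) :
    c * (heat q f k (x + 1) - 2 * heat q f k x + heat q f k (x - 1)) ≤
      e * (heat q f k x - heat q f k (x - 1)) := by
  induction k generalizing x with
  | zero => exact h x
  | succ k ih =>
    simp only [heat, heatStep]
    have a := mul_le_mul_of_nonneg_left (ih (x + 1)) h0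
    have b := mul_le_mul_of_nonneg_left (ih (x - 1)) h0
    have d := mul_le_mul_of_nonneg_left (ih x) (sub_nonneg.2 h1)
    simp only [sub_add_cancel, add_sub_cancel_right] at a b d ⊢
    linarith

lemma heatKernel_integrable (q : ℝ) (k : ℕ) (x : ℤ) :
    IntervalIntegrable
      (fun θ : ℝ => Real.cos (x * θ) * (1 - 2 * q + 2 * q * Real.cos θ) ^ k)
      MeasureTheory.volume 0 Real.pi :=
  Continuous.intervalIntegrable (by fun_prop) _ _

lemma heatKernel_succ (q : ℝ) (k : ℕ) (x : ℤ) :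
    heatKernel q (k + 1) x = heatStep q (heatKernel q k) x := by
  unfold heatStep heatKernel
  rw [← intervalIntegral.integral_const_mul, ← intervalIntegral.integral_const_mul,
    ← intervalIntegral.integral_const_mul,
    ← intervalIntegral.integral_add ((heatKernel_integrable q k _).const_mul _)
      ((heatKernel_integrable q k _).const_mul _),
    ← intervalIntegral.integral_add (((heatKernel_integrable q k _).const_mul _).add
      ((heatKernel_integrable q k _).const_mul _)) ((heatKernel_integrable q k _).const_mul _)]
  refine intervalIntegral.integral_congr fun θ _ => ?_
  push_cast
  simp only [add_mul, sub_mul, one_mul, Real.cos_add, Real.cos_sub]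
  ring

lemma heatKernel_zero (q : ℝ) (x : ℤ) :
    heatKernel q 0 x = if x = 0 then Real.pi else 0 := by
  unfold heatKernel
  split_ifs with h
  · simp [h]
  · have hx : (x : ℝ) ≠ 0 := by exact_mod_cast h
    simp only [pow_zero, mul_one]
    rw [intervalIntegral.integral_comp_mul_left _ hx]
    simp

lemma tendsto_heatKernel {q : ℝ} (h0 : 0 < q) (h1 : 2 * q ≤ 1) (x : ℤ) :
    Tendsto (fun k => heatKernel q k x) atTop (𝓝 0) := by
  have key : ∀ θ : ℝ, |1 - 2 * q + 2 * q * Real.cos θ| ≤ 1 := fun θ => by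
    rw [abs_le]
    constructor <;> nlinarith [Real.cos_le_one θ, Real.neg_one_le_cos θ]
  have := intervalIntegral.tendsto_integral_filter_of_dominated_convergence
    (μ := MeasureTheory.volume) (a := 0) (b := Real.pi) (l := atTop)
    (F := fun (k : ℕ) (θ : ℝ) => Real.cos (x * θ) * (1 - 2 * q + 2 * q * Real.cos θ) ^ k)
    (f := fun _ => 0) (fun _ => 1)
    (.of_forall fun k => by
      apply Continuous.aestronglyMeasurable
      fun_prop)
    (.of_forall fun k => .of_forall fun θ _ => by
      rw [Real.norm_eq_abs, abs_mul, abs_pow]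
      exact mul_le_one₀ (Real.abs_cos_le_one _) (by positivity)
        (pow_le_one₀ (abs_nonneg _) (key θ)))
    (by simp)
    (by
      filter_upwards [MeasureTheory.compl_mem_ae_iff.2
        (MeasureTheory.measure_singleton (μ := MeasureTheory.volume) Real.pi)] with θ hne hθ
      rw [Set.uIoc_of_le Real.pi_pos.le] at hθ
      have hlt : θ < Real.pi := lt_of_le_of_ne hθ.2 hne
      have c1 : Real.cos θ < 1 := by
        simpa using Real.cos_lt_cos_of_nonneg_of_le_pi le_rfl hlt.le hθ.1
      have c2 : -1 < Real.cos θ := by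
        simpa using Real.cos_lt_cos_of_nonneg_of_le_pi hθ.1.le le_rfl hlt
      have habs : |1 - 2 * q + 2 * q * Real.cos θ| < 1 := by
        rw [abs_lt]
        constructor <;> nlinarith
      simpa using (tendsto_pow_atTop_nhds_zero_of_abs_lt_one habs).const_mul (Real.cos (x * θ)))
  simpa [heatKernel] using this

/-- The walk started from `sgn` plus a constant plus finitely many point masses. -/
lemma heat_sgn_add_point_masses (q ε c : ℝ) (M k : ℕ) (x : ℤ) :
    heat q (fun y => sgn y + ε + c * ∑ a ∈ range M, heatKernel q 0 (y + a)) k x =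
      heat q sgn k x + ε + c * ∑ a ∈ range M, heatKernel q k (x + a) := by
  induction k generalizing x with
  | zero => rfl
  | succ k ih =>
    have hs : ∑ a ∈ range M, heatKernel q (k + 1) (x + a) =
        q * ∑ a ∈ range M, heatKernel q k (x + 1 + a) +
        (1 - 2 * q) * ∑ a ∈ range M, heatKernel q k (x + a) +
        q * ∑ a ∈ range M, heatKernel q k (x - 1 + a) := by
      simp only [Finset.mul_sum, ← Finset.sum_add_distrib]
      refine Finset.sum_congr rfl fun a _ => ?_
      rw [heatKernel_succ, heatStep, show x + a + 1 = x + 1 + a by ring,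
        show x + a - 1 = x - 1 + a by ring]
    rw [hs]
    simp only [heat, heatStep, ih]
    ring

/-- A smoothed sign function, approaching `±1` geometrically at rate `r`. -/
def geomSign (r : ℝ) (x : ℤ) : ℝ := if 0 ≤ x then 1 - r ^ (-x) else r ^ x - 1

lemma geomSign_of_nonneg (r : ℝ) {x : ℤ} (h : 0 ≤ x) : geomSign r x = 1 - r ^ (-x) := if_pos h

lemma geomSign_of_nonpos (r : ℝ) {x : ℤ} (h : x ≤ 0) : geomSign r x = r ^ x - 1 := by
  rcases h.eq_or_lt with rfl | h
  · simp [geomSign]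
  · exact if_neg (by omega)

lemma geomSign_le_one {r : ℝ} (h : 1 < r) (x : ℤ) : geomSign r x ≤ 1 := by
  rcases le_total 0 x with hx | hx
  · have : 0 < r ^ (-x) := zpow_pos (by linarith) _
    rw [geomSign_of_nonneg r hx]
    linarith
  · have := zpow_le_one_of_nonpos₀ h.le hx
    rw [geomSign_of_nonpos r hx]
    linarith

lemma neg_one_le_geomSign {r : ℝ} (h : 1 < r) (x : ℤ) : -1 ≤ geomSign r x := by
  rcases le_total 0 x with hx | hx
  · have := zpow_le_one_of_nonpos₀ h.le (show -x ≤ 0 by omega)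
    rw [geomSign_of_nonneg r hx]
    linarith
  · have : 0 < r ^ x := zpow_pos (by linarith) _
    rw [geomSign_of_nonpos r hx]
    linarith

lemma geomSign_second_difference {c e : ℝ} (hc : |c| ≤ 1) (he : 0 < e) (x : ℤ) :
    c * (geomSign (1 + e) (x + 1) - 2 * geomSign (1 + e) x + geomSign (1 + e) (x - 1)) ≤
      e * (geomSign (1 + e) x - geomSign (1 + e) (x - 1)) := by
  have hr : 1 + e ≠ 0 := by positivity
  obtain ⟨hc1, hc2⟩ := abs_le.1 hc
  rcases lt_trichotomy x 0 with hx | rfl | hx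
  · rw [geomSign_of_nonpos _ (by omega), geomSign_of_nonpos _ (by omega),
      geomSign_of_nonpos _ (by omega), zpow_add_one₀ hr]
    have h : (1 + e) ^ x = (1 + e) ^ (x - 1) * (1 + e) := by
      rw [← zpow_add_one₀ hr, sub_add_cancel]
    have hp : 0 < (1 + e) ^ (x - 1) := by positivity
    rw [h]
    have : 0 ≤ (1 - c) * (e ^ 2 * (1 + e) ^ (x - 1)) :=
      mul_nonneg (by linarith) (by positivity)
    linarith
  · rw [geomSign_of_nonneg _ (by omega), geomSign_of_nonneg _ le_rfl,
      geomSign_of_nonpos _ (by omega)]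
    have : (1 + e)⁻¹ ≤ 1 := inv_le_one_of_one_le₀ (by linarith)
    norm_num
    nlinarith
  · rw [geomSign_of_nonneg _ (by omega), geomSign_of_nonneg _ (by omega),
      geomSign_of_nonneg _ (by omega)]
    have h1 : (1 + e) ^ (-x) = (1 + e) ^ (-(x + 1)) * (1 + e) := by
      rw [← zpow_add_one₀ hr]
      congr 1
      ring
    have h2 : (1 + e) ^ (-(x - 1)) = (1 + e) ^ (-(x + 1)) * (1 + e) * (1 + e) := by
      rw [← h1, ← zpow_add_one₀ hr]
      congr 1
      ring
    rw [h1, h2]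
    have hp : 0 < (1 + e) ^ (-(x + 1)) := by positivity
    have : 0 ≤ (1 + c + e) * (e ^ 2 * (1 + e) ^ (-(x + 1))) :=
      mul_nonneg (by linarith) (by positivity)
    linarith

/-- The smoothed sign, shifted so as to dominate `sgn`. -/
def smoothPayoff (r : ℝ) (m : ℕ) (x : ℤ) : ℝ := geomSign r (x + m) + r⁻¹ ^ m

lemma sgn_le_smoothPayoff {r : ℝ} (h : 1 < r) (m : ℕ) (x : ℤ) : sgn x ≤ smoothPayoff r m x := by
  have hp : 0 < r⁻¹ ^ m := by positivity
  unfold smoothPayoff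
  rcases lt_or_ge x 0 with hx | hx
  · have := neg_one_le_geomSign h (x + m)
    rw [sgn, if_neg (by omega), if_pos hx]
    linarith
  · have h1 : sgn x ≤ 1 := by
      unfold sgn
      split_ifs <;> norm_num
    have : r ^ (-(x + m)) ≤ r⁻¹ ^ m := by
      rw [inv_pow, ← zpow_natCast, ← zpow_neg]
      exact zpow_le_zpow_right₀ h.le (by omega)
    rw [geomSign_of_nonneg r (by omega)]
    linarith

lemma smoothPayoff_second_difference {c e : ℝ} (hc : |c| ≤ 1) (he : 0 < e) (m : ℕ) (x : ℤ) :
    c * (smoothPayoff (1 + e) m (x + 1) - 2 * smoothPayoff (1 + e) m x +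
        smoothPayoff (1 + e) m (x - 1)) ≤
      e * (smoothPayoff (1 + e) m x - smoothPayoff (1 + e) m (x - 1)) := by
  have := geomSign_second_difference hc he (x + m)
  unfold smoothPayoff
  rw [show x + 1 + m = x + m + 1 by ring, show x - 1 + m = x + m - 1 by ring]
  linarith

lemma smoothPayoff_le_sgn_add_point_masses {r : ℝ} (h : 1 < r) (q : ℝ) (m : ℕ) (x : ℤ) :
    smoothPayoff r m x ≤ sgn x + 2 * r⁻¹ ^ m +
      2 / Real.pi * ∑ a ∈ range (2 * m), heatKernel q 0 (x + a) := by
  have hk : ∀ a : ℕ, 0 ≤ heatKernel q 0 (x + a) := fun a => by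
    rw [heatKernel_zero]
    split_ifs <;> positivity
  have hS : 0 ≤ 2 / Real.pi * ∑ a ∈ range (2 * m), heatKernel q 0 (x + a) :=
    mul_nonneg (by positivity) (Finset.sum_nonneg fun a _ => hk a)
  have hp : 0 < r⁻¹ ^ m := by positivity
  have hG := geomSign_le_one h (x + m)
  unfold smoothPayoff
  rcases lt_or_ge 0 x with hx | hx
  · rw [sgn, if_pos hx]
    linarith
  have hsgn : -1 ≤ sgn x := by
    unfold sgn
    split_ifs <;> norm_num
  obtain ⟨n, rfl⟩ : ∃ n : ℕ, x = -n := ⟨x.natAbs, by omega⟩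
  rcases lt_or_ge n (2 * m) with hn | hn
  · have hle : Real.pi ≤ ∑ a ∈ range (2 * m), heatKernel q 0 (-(n : ℤ) + a) := by
      refine le_trans (le_of_eq ?_)
        (Finset.single_le_sum (fun a _ => hk a) (Finset.mem_range.2 hn))
      rw [heatKernel_zero, if_pos (by omega)]
    have h2 : 2 ≤ 2 / Real.pi * ∑ a ∈ range (2 * m), heatKernel q 0 (-(n : ℤ) + a) := by
      calc (2 : ℝ) = 2 / Real.pi * Real.pi := by field_simp
        _ ≤ _ := mul_le_mul_of_nonneg_left hle (by positivity)
    linarith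
  · have : r ^ (-(n : ℤ) + m) ≤ r⁻¹ ^ m := by
      rw [inv_pow, ← zpow_natCast, ← zpow_neg]
      exact zpow_le_zpow_right₀ h.le (by omega)
    rw [geomSign_of_nonpos r (by omega)]
    linarith

lemma heat_sgn_le_bellman {pw pd pl q : ℝ} (h0 : 0 ≤ q) (h1 : 2 * q ≤ 1) (k : ℕ) (x : ℤ) :
    heat q sgn k x ≤ bellman pw pd pl q (1 - 2 * q) q k x := by
  induction k generalizing x with
  | zero => exact le_rfl
  | succ k ih => exact (heatStep_mono h0 h1 ih x).trans (le_max_right _ _)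

/-- Always playing defense against a smoothed terminal payoff dominates the optimal play. -/
lemma bellman_le_heat_smoothPayoff {pw pd pl q : ℝ} (hpw : 0 ≤ pw) (hpd : 0 ≤ pd)
    (hpl : 0 ≤ pl) (hp : pw + pd + pl = 1) (h0 : 0 ≤ q) (h1 : 2 * q ≤ 1)
    (hlose : pw < pl) (m k : ℕ) (x : ℤ) :
    bellman pw pd pl q (1 - 2 * q) q k x ≤ heat q (smoothPayoff (1 + (pl - pw)) m) k x := by
  induction k generalizing x with
  | zero => exact sgn_le_smoothPayoff (by linarith) m x
  | succ k ih =>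
    refine max_le ?_ (heatStep_mono h0 h1 ih x)
    have a := mul_le_mul_of_nonneg_left (ih (x + 1)) hpw
    have b := mul_le_mul_of_nonneg_left (ih x) hpd
    have c := mul_le_mul_of_nonneg_left (ih (x - 1)) hpl
    have hc : |pw - q| ≤ 1 := abs_le.2 ⟨by linarith, by linarith⟩
    have d := heat_second_difference h0 h1
      (smoothPayoff_second_difference hc (sub_pos.2 hlose) m) k x
    obtain rfl : pd = 1 - pw - pl := by linarith
    simp only [heat, heatStep]
    linarith

/-- If offense is strictly losing (`pw < pl`) and the defensive style
is fair but non-safe (`qw = ql > 0`), then `g*_N ≥ 0` for every `N ≥ 1` and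
`g*_N → 0` as `N → ∞`. -/
theorem gOpt_nonneg_and_tendsto_zero_of_fair_nonsafe
    (pw pd pl qw qd ql : ℝ)
    (hpw : 0 ≤ pw) (hpd : 0 ≤ pd) (hpl : 0 ≤ pl) (hp : pw + pd + pl = 1)
    (hqw : 0 ≤ qw) (hqd : 0 ≤ qd) (hql : 0 ≤ ql) (hq : qw + qd + ql = 1)
    (hlosep : pw < pl) (hfair : qw = ql) (hq0 : 0 < ql) :
    (∀ N : ℕ, 1 ≤ N → 0 ≤ gOpt pw pd pl qw qd ql N) ∧
      Tendsto (fun N : ℕ => gOpt pw pd pl qw qd ql N) atTop (𝓝 0) := by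
  subst hfair
  obtain rfl : qd = 1 - 2 * qw := by linarith
  have h1 : 2 * qw ≤ 1 := by linarith
  have lower : ∀ N, 0 ≤ gOpt pw pd pl qw (1 - 2 * qw) qw N := fun N =>
    (heat_sgn_zero qw N).symm.le.trans (heat_sgn_le_bellman hqw h1 N 0)
  refine ⟨fun N _ => lower N, ?_⟩
  have hr : 1 < 1 + (pl - pw) := by linarith
  have upper : ∀ m N, gOpt pw pd pl qw (1 - 2 * qw) qw N ≤ 2 * (1 + (pl - pw))⁻¹ ^ m +
      2 / Real.pi * ∑ a ∈ range (2 * m), heatKernel qw N (0 + a) := fun m N => by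
    have a := bellman_le_heat_smoothPayoff hpw hpd hpl hp hqw h1 hlosep m N 0
    have b := heat_mono hqw h1 (smoothPayoff_le_sgn_add_point_masses hr qw m) N 0
    rw [heat_sgn_add_point_masses, heat_sgn_zero, zero_add] at b
    exact a.trans b
  have decay : ∀ m, Tendsto (fun N => 2 / Real.pi *
      ∑ a ∈ range (2 * m), heatKernel qw N (0 + a)) atTop (𝓝 0) := fun m => by
    have := (tendsto_finsetSum (range (2 * m)) fun (a : ℕ) _ =>
      tendsto_heatKernel hq0 h1 (0 + a)).const_mul (2 / Real.pi)
    simpa only [Finset.sum_const_zero, mul_zero] using this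
  have small : Tendsto (fun m : ℕ => 2 * (1 + (pl - pw))⁻¹ ^ m) atTop (𝓝 0) := by
    simpa only [mul_zero] using (tendsto_pow_atTop_nhds_zero_of_lt_one
      (by positivity) (inv_lt_one_of_one_lt₀ hr)).const_mul (2 : ℝ)
  rw [Metric.tendsto_atTop]
  intro ε hε
  obtain ⟨m, hm⟩ := (small.eventually_lt_const (half_pos hε)).exists
  obtain ⟨N₀, hN₀⟩ := eventually_atTop.1 ((decay m).eventually_lt_const (half_pos hε))
  refine ⟨N₀, fun N hN => ?_⟩
  rw [Real.dist_eq, sub_zero, abs_of_nonneg (lower N)]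
  linarith [upper m N, hN₀ N hN]
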